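/- arXiv:2108.05645 — 7 statements merged into one kernel-verified Lean document; each statement's English description precedes it below -/
import Mathlib

section
/- Let n ≥ 1 and m > n be integers, let w ∈ 𝔻, let ψ₀ and ψₙ be analytic functions on 𝔻, and let φ₀ and φₙ be analytic self-maps of 𝔻 with φ₀(w) = w and φₙ(w) = w. Suppose ψₙ has a zero at w of order at least n. Then there exist complex constants c₀, …, c_{m−1}, depending only on ψ₀, φ₀, ψₙ, φₙ, w and not on f, such that for every analytic function f on 𝔻, the m-th derivative of z ↦ ψ₀(z)·f(φ₀(z)) + ψₙ(z)·f⁽ⁿ⁾(φₙ(z)) at the point w equals Σ_{j=0}^{m−1} c_j·f⁽ʲ⁾(w) + (ψ₀(w)·(φ₀′(w))^m + C(m,n)·ψₙ⁽ⁿ⁾(w)·(φₙ′(w))^{m−n})·f⁽ᵐ⁾(w), where C(m,n) denotes the binomial coefficient. -/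
theorem AnalyticAt.iteratedDeriv {f : ℂ → ℂ} {w : ℂ} (hf : AnalyticAt ℂ f w) (n : ℕ) :
    AnalyticAt ℂ (iteratedDeriv n f) w := by
  rw [iteratedDeriv_eq_iterate]
  exact hf.iterated_deriv n

/-- A functional `T` depends, on functions analytic at `w`, linearly on the derivatives at `w` of
order less than `M` only. -/
def DependsOnJet (w : ℂ) (M : ℕ) (T : (ℂ → ℂ) → ℂ) : Prop :=
  ∃ c : ℕ → ℂ, ∀ f : ℂ → ℂ, AnalyticAt ℂ f w →
    T f = ∑ j ∈ Finset.range M, c j * iteratedDeriv j f w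

namespace DependsOnJet

variable {w : ℂ} {M N : ℕ} {S T : (ℂ → ℂ) → ℂ}

theorem congr (hT : DependsOnJet w M T) (h : ∀ f, AnalyticAt ℂ f w → S f = T f) :
    DependsOnJet w M S := by
  obtain ⟨c, hc⟩ := hT
  exact ⟨c, fun f hf => (h f hf).trans (hc f hf)⟩

theorem zero : DependsOnJet w M (fun _ => 0) := ⟨0, by simp⟩

theorem add (hS : DependsOnJet w M S) (hT : DependsOnJet w M T) :
    DependsOnJet w M (fun f => S f + T f) := by
  obtain ⟨c, hc⟩ := hS
  obtain ⟨d, hd⟩ := hT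
  refine ⟨fun j => c j + d j, fun f hf => ?_⟩
  simp only [hc f hf, hd f hf, add_mul, Finset.sum_add_distrib]

theorem const_mul (a : ℂ) (hT : DependsOnJet w M T) : DependsOnJet w M (fun f => a * T f) := by
  obtain ⟨c, hc⟩ := hT
  refine ⟨fun j => a * c j, fun f hf => ?_⟩
  simp only [hc f hf, Finset.mul_sum, mul_assoc]

theorem sum {ι : Type*} {s : Finset ι} {U : ι → (ℂ → ℂ) → ℂ}
    (h : ∀ i ∈ s, DependsOnJet w M (U i)) : DependsOnJet w M (fun f => ∑ i ∈ s, U i f) := by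
  classical
  induction s using Finset.induction_on with
  | empty => simpa using zero
  | insert a s ha ih =>
    simp only [Finset.sum_insert ha]
    exact (h a (by simp)).add (ih fun i hi => h i (by simp [hi]))

theorem iteratedDeriv_apply {k : ℕ} (hk : k < M) :
    DependsOnJet w M (fun f => iteratedDeriv k f w) :=
  ⟨fun j => if j = k then 1 else 0, fun f _ => by simp [hk]⟩

theorem mono (hMN : M ≤ N) (hT : DependsOnJet w M T) : DependsOnJet w N T := by
  obtain ⟨c, hc⟩ := hT
  refine congr (sum (s := Finset.range M) (U := fun j f => c j * iteratedDeriv j f w)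
    fun j hj => const_mul _ (iteratedDeriv_apply ?_)) hc
  exact (Finset.mem_range.1 hj).trans_le hMN

theorem comp_iteratedDeriv (n : ℕ) (hT : DependsOnJet w M T) :
    DependsOnJet w (M + n) (fun f => T (iteratedDeriv n f)) := by
  obtain ⟨c, hc⟩ := hT
  refine congr (sum (s := Finset.range M) (U := fun j f => c j * iteratedDeriv (j + n) f w)
    fun j hj => const_mul _ (iteratedDeriv_apply ?_)) fun f hf => ?_
  · have := Finset.mem_range.1 hj
    lia
  · rw [hc _ (hf.iteratedDeriv n)]
    simp only [iteratedDeriv_eq_iterate, Function.iterate_add_apply]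

end DependsOnJet

/-- The `k`-th derivative of a weighted composition at a fixed point `w`, up to derivatives of
order less than `k`. -/
theorem dependsOnJet_iteratedDeriv_mul_comp {w : ℂ} {φ : ℂ → ℂ} (hφ : AnalyticAt ℂ φ w)
    (hfix : φ w = w) (k : ℕ) {ψ : ℂ → ℂ} (hψ : AnalyticAt ℂ ψ w) :
    DependsOnJet w k (fun f => iteratedDeriv k (fun z => ψ z * f (φ z)) w
      - ψ w * deriv φ w ^ k * iteratedDeriv k f w) := by
  induction k generalizing ψ with
  | zero => exact DependsOnJet.zero.congr fun f _ => by simp [hfix]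
  | succ k ih =>
    have h₁ := (ih hψ.deriv).mono k.le_succ
    have h₂ := (ih (hψ.mul hφ.deriv)).comp_iteratedDeriv 1
    have h₃ := (DependsOnJet.iteratedDeriv_apply (w := w) k.lt_succ_self).const_mul
      (deriv ψ w * deriv φ w ^ k)
    refine ((h₁.add h₂).add h₃).congr fun f hf => ?_
    have hf' : AnalyticAt ℂ f (φ w) := by rwa [hfix]
    have hd : deriv (fun z => ψ z * f (φ z)) =ᶠ[nhds w]
        fun z => deriv ψ z * f (φ z) + (ψ * deriv φ) z * deriv f (φ z) := by
      filter_upwards [hψ.eventually_analyticAt, hφ.eventually_analyticAt,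
        hφ.continuousAt.eventually hf'.eventually_analyticAt] with z h₁ h₂ h₃
      have := h₁.differentiableAt.hasDerivAt.mul
        (h₃.differentiableAt.hasDerivAt.comp z h₂.differentiableAt.hasDerivAt)
      refine (this.deriv).trans ?_
      simp only [Function.comp_apply, Pi.mul_apply]
      ring
    have hA : AnalyticAt ℂ (fun z => deriv ψ z * f (φ z)) w := hψ.deriv.mul (hf'.comp hφ)
    have hB : AnalyticAt ℂ (fun z => (ψ * deriv φ) z * deriv f (φ z)) w :=
      (hψ.mul hφ.deriv).mul (hf'.deriv.comp hφ)
    rw [iteratedDeriv_succ', hd.iteratedDeriv_eq, iteratedDeriv_fun_add hA.contDiffAt hB.contDiffAt,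
      iteratedDeriv_one, iteratedDeriv_succ']
    simp only [Pi.mul_apply]
    ring

/-- The `m`-th derivative of `z ↦ ψ z * f⁽ⁿ⁾ (φ z)` at a fixed point `w` where `ψ` vanishes to
order at least `n`, up to derivatives of order less than `m`. -/
theorem dependsOnJet_iteratedDeriv_mul_iteratedDeriv_comp {w : ℂ} {φ ψ : ℂ → ℂ}
    (hφ : AnalyticAt ℂ φ w) (hfix : φ w = w) (hψ : AnalyticAt ℂ ψ w) {n m : ℕ} (hnm : n ≤ m)
    (hzero : ∀ k < n, iteratedDeriv k ψ w = 0) :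
    DependsOnJet w m (fun f => iteratedDeriv m (fun z => ψ z * iteratedDeriv n f (φ z)) w
      - m.choose n * iteratedDeriv n ψ w * deriv φ w ^ (m - n) * iteratedDeriv m f w) := by
  have hcomp (i : ℕ) : DependsOnJet w (m - i + n) (fun f =>
      iteratedDeriv (m - i) (fun z => iteratedDeriv n f (φ z)) w
        - deriv φ w ^ (m - i) * iteratedDeriv (m - i + n) f w) := by
    refine ((dependsOnJet_iteratedDeriv_mul_comp hφ hfix (m - i)
      (analyticAt_const (v := (1 : ℂ)))).comp_iteratedDeriv n).congr fun f _ => ?_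
    simp only [one_mul, iteratedDeriv_eq_iterate, Function.iterate_add_apply]
  have hlow : DependsOnJet w m (fun f => ∑ i ∈ Finset.range (m + 1),
      (m.choose i * iteratedDeriv i ψ w * iteratedDeriv (m - i)
        (fun z => iteratedDeriv n f (φ z)) w - if i = n then
          m.choose n * iteratedDeriv n ψ w * deriv φ w ^ (m - n) * iteratedDeriv m f w else 0)) := by
    refine DependsOnJet.sum fun i hi => ?_
    have him : i ≤ m := Nat.lt_succ_iff.1 (Finset.mem_range.1 hi)
    rcases lt_trichotomy i n with h | rfl | h
    · exact DependsOnJet.zero.congr fun f _ => by simp [hzero i h, h.ne]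
    · have := (hcomp i).const_mul (m.choose i * iteratedDeriv i ψ w)
      rw [Nat.sub_add_cancel him] at this
      exact this.congr fun f _ => by simp only [if_true]; ring
    · have hlt : m - i + n < m := by lia
      refine ((((hcomp i).mono hlt.le).add ((DependsOnJet.iteratedDeriv_apply hlt).const_mul
        (deriv φ w ^ (m - i)))).const_mul (m.choose i * iteratedDeriv i ψ w)).congr fun f _ => ?_
      simp only [h.ne', if_false]
      ring
  refine hlow.congr fun f hf => ?_
  have hf' : AnalyticAt ℂ (iteratedDeriv n f) (φ w) := by
    rw [hfix]
    exact hf.iteratedDeriv n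
  have hg : AnalyticAt ℂ (fun z => iteratedDeriv n f (φ z)) w := hf'.comp hφ
  rw [iteratedDeriv_fun_mul hψ.contDiffAt hg.contDiffAt, Finset.sum_sub_distrib,
    Finset.sum_ite_eq' (Finset.range (m + 1)) n]
  simp [Nat.lt_succ_of_le hnm]


/-- Lemma 2 (i): the `m`-th derivative (`m > n`) of
`z ↦ ψ₀ z * f (φ₀ z) + ψₙ z * f⁽ⁿ⁾ (φₙ z)` at a fixed point `w` in the open unit disk,
where `ψₙ` vanishes at `w` to order at least `n`. -/
theorem stmt_0 (n m : ℕ) (hn : 1 ≤ n) (hm : n < m)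
    (w : ℂ) (hw : w ∈ Metric.ball (0 : ℂ) 1)
    (ψ₀ ψₙ φ₀ φₙ : ℂ → ℂ)
    (hψ₀ : DifferentiableOn ℂ ψ₀ (Metric.ball 0 1))
    (hψₙ : DifferentiableOn ℂ ψₙ (Metric.ball 0 1))
    (hφ₀ : DifferentiableOn ℂ φ₀ (Metric.ball 0 1))
    (hφₙ : DifferentiableOn ℂ φₙ (Metric.ball 0 1))
    (hφ₀m : Set.MapsTo φ₀ (Metric.ball 0 1) (Metric.ball 0 1))
    (hφₙm : Set.MapsTo φₙ (Metric.ball 0 1) (Metric.ball 0 1))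
    (hfix₀ : φ₀ w = w) (hfixₙ : φₙ w = w)
    (hzero : ∀ k < n, iteratedDeriv k ψₙ w = 0) :
    ∃ c : ℕ → ℂ, ∀ f : ℂ → ℂ, DifferentiableOn ℂ f (Metric.ball 0 1) →
      iteratedDeriv m (fun z => ψ₀ z * f (φ₀ z) + ψₙ z * iteratedDeriv n f (φₙ z)) w
        = (∑ j ∈ Finset.range m, c j * iteratedDeriv j f w)
          + (ψ₀ w * (deriv φ₀ w) ^ m
              + (m.choose n : ℂ) * iteratedDeriv n ψₙ w * (deriv φₙ w) ^ (m - n))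
            * iteratedDeriv m f w := by
  have hmem : Metric.ball (0 : ℂ) 1 ∈ nhds w := Metric.isOpen_ball.mem_nhds hw
  have hψ₀w := hψ₀.analyticAt hmem
  have hψₙw := hψₙ.analyticAt hmem
  have hφ₀w := hφ₀.analyticAt hmem
  have hφₙw := hφₙ.analyticAt hmem
  obtain ⟨c, hc⟩ := (dependsOnJet_iteratedDeriv_mul_comp hφ₀w hfix₀ m hψ₀w).add
    (dependsOnJet_iteratedDeriv_mul_iteratedDeriv_comp hφₙw hfixₙ hψₙw hm.le hzero)
  refine ⟨c, fun f hf => ?_⟩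
  have hfw := hf.analyticAt hmem
  have hA : AnalyticAt ℂ (fun z => ψ₀ z * f (φ₀ z)) w :=
    hψ₀w.mul (AnalyticAt.comp (by rwa [hfix₀]) hφ₀w)
  have hB : AnalyticAt ℂ (fun z => ψₙ z * iteratedDeriv n f (φₙ z)) w :=
    hψₙw.mul (AnalyticAt.comp (g := iteratedDeriv n f)
      (by rw [hfixₙ]; exact hfw.iteratedDeriv n) hφₙw)
  rw [← hc f hfw, iteratedDeriv_fun_add hA.contDiffAt hB.contDiffAt]
  ring
end

section
/- Let n ≥ 1 be an integer, let w ∈ 𝔻, let ψ₀ and ψₙ be analytic functions on 𝔻, and let φ₀ and φₙ be analytic self-maps of 𝔻 with φ₀(w) = w and φₙ(w) = w. Suppose ψₙ has a zero at w of order at least n. Then there exist complex constants c₀, …, c_{n−1}, depending only on ψ₀, φ₀, ψₙ, φₙ, w and not on f, such that for every analytic function f on 𝔻, the n-th derivative of z ↦ ψ₀(z)·f(φ₀(z)) + ψₙ(z)·f⁽ⁿ⁾(φₙ(z)) at the point w equals Σ_{j=0}^{n−1} c_j·f⁽ʲ⁾(w) + (ψ₀(w)·(φ₀′(w))^n + ψₙ⁽ⁿ⁾(w))·f⁽ⁿ⁾(w).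 -/
/-- Faà di Bruno structure: the `n`-th derivative of a weighted composition operator applied to `f`
is a combination of the derivatives of `f` of order at most `n`, with coefficients independent of
`f` and an explicit leading coefficient. -/
theorem exists_iteratedDeriv_mul_comp_eq_sum {U V : Set ℂ} (hU : IsOpen U) (hV : IsOpen V)
    {φ : ℂ → ℂ} (hφ : DifferentiableOn ℂ φ U) (hm : Set.MapsTo φ U V) {w : ℂ} (hw : w ∈ U)
    (n : ℕ) {ψ : ℂ → ℂ} (hψ : DifferentiableOn ℂ ψ U) :
    ∃ c : ℕ → ℂ, ∀ f : ℂ → ℂ, DifferentiableOn ℂ f V →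
      iteratedDeriv n (fun z => ψ z * f (φ z)) w
        = (∑ j ∈ Finset.range n, c j * iteratedDeriv j f (φ w))
          + ψ w * (deriv φ w) ^ n * iteratedDeriv n f (φ w) := by
  induction n generalizing ψ with
  | zero => exact ⟨0, fun f _ => by simp⟩
  | succ n ih =>
    have hψ' : DifferentiableOn ℂ (deriv ψ) U := hψ.deriv hU
    have hψφ' : DifferentiableOn ℂ (fun z => ψ z * deriv φ z) U := hψ.mul (hφ.deriv hU)
    obtain ⟨a, ha⟩ := ih hψ'
    obtain ⟨b, hb⟩ := ih hψφ'
    refine ⟨fun j => (if j < n then a j else deriv ψ w * deriv φ w ^ n)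
      + (if j = 0 then 0 else b (j - 1)), fun f hf => ?_⟩
    have hf' : DifferentiableOn ℂ (deriv f) V := hf.deriv hV
    have hderiv : deriv (fun z => ψ z * f (φ z)) =ᶠ[nhds w]
        fun z => deriv ψ z * f (φ z) + ψ z * deriv φ z * deriv f (φ z) := by
      filter_upwards [hU.mem_nhds hw] with z hz
      have h₁ := (hψ.differentiableAt (hU.mem_nhds hz)).hasDerivAt
      have h₂ := (hφ.differentiableAt (hU.mem_nhds hz)).hasDerivAt
      have h₃ := (hf.differentiableAt (hV.mem_nhds (hm hz))).hasDerivAt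
      refine (h₁.mul (h₃.comp z h₂)).deriv.trans ?_
      simp only [Function.comp_apply]
      ring
    have hA : ContDiffAt ℂ n (fun z => deriv ψ z * f (φ z)) w :=
      ((hψ'.mul (hf.comp hφ hm)).contDiffOn hU).contDiffAt (hU.mem_nhds hw)
    have hB : ContDiffAt ℂ n (fun z => ψ z * deriv φ z * deriv f (φ z)) w :=
      ((hψφ'.mul (hf'.comp hφ hm)).contDiffOn hU).contDiffAt (hU.mem_nhds hw)
    rw [iteratedDeriv_succ', hderiv.iteratedDeriv_eq, iteratedDeriv_fun_add hA hB, ha f hf,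
      hb _ hf']
    simp only [← iteratedDeriv_succ', add_mul, Finset.sum_add_distrib]
    rw [Finset.sum_range_succ,
      Finset.sum_range_succ' (fun j => (if j = 0 then 0 else b (j - 1)) * _)]
    have hsum : ∑ j ∈ Finset.range n,
        (if j < n then a j else deriv ψ w * deriv φ w ^ n) * iteratedDeriv j f (φ w)
        = ∑ j ∈ Finset.range n, a j * iteratedDeriv j f (φ w) :=
      Finset.sum_congr rfl fun j hj => by rw [if_pos (Finset.mem_range.mp hj)]
    rw [hsum]
    simp
    ring

/-- If `g` vanishes at `w` to order at least `n`, only the top term of the Leibniz formula for the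
`n`-th derivative of `g * h` at `w` survives. -/
theorem iteratedDeriv_mul_eq_of_iteratedDeriv_eq_zero {n : ℕ} {g h : ℂ → ℂ} {w : ℂ}
    (hg : ContDiffAt ℂ n g w) (hh : ContDiffAt ℂ n h w)
    (hzero : ∀ k < n, iteratedDeriv k g w = 0) :
    iteratedDeriv n (fun z => g z * h z) w = iteratedDeriv n g w * h w := by
  rw [iteratedDeriv_fun_mul hg hh, Finset.sum_range_succ, Finset.sum_eq_zero]
  · simp
  · intro k hk
    simp [hzero k (Finset.mem_range.mp hk)]

/-- Lemma 2 (ii): the `n`-th derivative of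
`z ↦ ψ₀ z * f (φ₀ z) + ψₙ z * f⁽ⁿ⁾ (φₙ z)` at a fixed point `w` in the open unit disk,
where `ψₙ` vanishes at `w` to order at least `n`. -/
theorem stmt_1 (n : ℕ) (hn : 1 ≤ n)
    (w : ℂ) (hw : w ∈ Metric.ball (0 : ℂ) 1)
    (ψ₀ ψₙ φ₀ φₙ : ℂ → ℂ)
    (hψ₀ : DifferentiableOn ℂ ψ₀ (Metric.ball 0 1))
    (hψₙ : DifferentiableOn ℂ ψₙ (Metric.ball 0 1))
    (hφ₀ : DifferentiableOn ℂ φ₀ (Metric.ball 0 1))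
    (hφₙ : DifferentiableOn ℂ φₙ (Metric.ball 0 1))
    (hφ₀m : Set.MapsTo φ₀ (Metric.ball 0 1) (Metric.ball 0 1))
    (hφₙm : Set.MapsTo φₙ (Metric.ball 0 1) (Metric.ball 0 1))
    (hfix₀ : φ₀ w = w) (hfixₙ : φₙ w = w)
    (hzero : ∀ k < n, iteratedDeriv k ψₙ w = 0) :
    ∃ c : ℕ → ℂ, ∀ f : ℂ → ℂ, DifferentiableOn ℂ f (Metric.ball 0 1) →
      iteratedDeriv n (fun z => ψ₀ z * f (φ₀ z) + ψₙ z * iteratedDeriv n f (φₙ z)) w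
        = (∑ j ∈ Finset.range n, c j * iteratedDeriv j f w)
          + (ψ₀ w * (deriv φ₀ w) ^ n + iteratedDeriv n ψₙ w) * iteratedDeriv n f w := by
  have hD : IsOpen (Metric.ball (0 : ℂ) 1) := Metric.isOpen_ball
  obtain ⟨c, hc⟩ := exists_iteratedDeriv_mul_comp_eq_sum hD hD hφ₀ hφ₀m hw n hψ₀
  refine ⟨c, fun f hf => ?_⟩
  have hfn : DifferentiableOn ℂ (iteratedDeriv n f) (Metric.ball 0 1) := by
    rw [iteratedDeriv_eq_iterate]
    exact ((hf.analyticOnNhd hD).iterated_deriv n).differentiableOn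
  have hg : ContDiffAt ℂ n ψₙ w := (hψₙ.contDiffOn hD).contDiffAt (hD.mem_nhds hw)
  have hh : ContDiffAt ℂ n (fun z => iteratedDeriv n f (φₙ z)) w :=
    ((hfn.comp hφₙ hφₙm).contDiffOn hD).contDiffAt (hD.mem_nhds hw)
  have hA : ContDiffAt ℂ n (fun z => ψ₀ z * f (φ₀ z)) w :=
    ((hψ₀.mul (hf.comp hφ₀ hφ₀m)).contDiffOn hD).contDiffAt (hD.mem_nhds hw)
  rw [iteratedDeriv_fun_add hA (hg.mul hh), hc f hf,
    iteratedDeriv_mul_eq_of_iteratedDeriv_eq_zero hg hh hzero, hfix₀, hfixₙ]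
  ring
end

section
/- Let n ≥ 1 and 0 ≤ m < n be integers, let w ∈ 𝔻, let ψ₀ and ψₙ be analytic functions on 𝔻, and let φ₀ and φₙ be analytic self-maps of 𝔻 with φ₀(w) = w and φₙ(w) = w. Suppose ψₙ has a zero at w of order at least n. Then there exist complex constants c₀, …, c_{m−1}, depending only on ψ₀, φ₀, w and not on f, such that for every analytic function f on 𝔻, the m-th derivative of z ↦ ψ₀(z)·f(φ₀(z)) + ψₙ(z)·f⁽ⁿ⁾(φₙ(z)) at the point w equals Σ_{j=0}^{m−1} c_j·f⁽ʲ⁾(w) + ψ₀(w)·(φ₀′(w))^m·f⁽ᵐ⁾(w); in particular, the m-th derivative of z ↦ ψₙ(z)·f⁽ⁿ⁾(φₙ(z)) at w equals 0. -/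
open Filter Topology in
/-- At a fixed point `w` of `φ`, the `m`-th derivative of `ψ * (f ∘ φ)` is a linear combination of
the derivatives of `f` at `w` of order at most `m`, with top coefficient `ψ w * (deriv φ w) ^ m` and
all coefficients independent of `f`. -/
theorem exists_iteratedDeriv_mul_comp_eq_of_fixed {φ : ℂ → ℂ} {w : ℂ} (hφ : AnalyticAt ℂ φ w)
    (hfix : φ w = w) (m : ℕ) {ψ : ℂ → ℂ} (hψ : AnalyticAt ℂ ψ w) :
    ∃ c : ℕ → ℂ, ∀ f : ℂ → ℂ, AnalyticAt ℂ f w →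
      iteratedDeriv m (fun z => ψ z * f (φ z)) w
        = (∑ j ∈ Finset.range m, c j * iteratedDeriv j f w)
          + ψ w * (deriv φ w) ^ m * iteratedDeriv m f w := by
  induction m generalizing ψ with
  | zero => exact ⟨0, fun f _ => by simp [hfix]⟩
  | succ m ih =>
    obtain ⟨c, hc⟩ := ih hψ.deriv
    obtain ⟨d, hd⟩ := ih (hψ.mul hφ.deriv)
    refine ⟨fun j => (if j < m then c j else deriv ψ w * deriv φ w ^ m) +
      (if j = 0 then 0 else d (j - 1)), fun f hf => ?_⟩
    have hcomp : ∀ {g : ℂ → ℂ}, AnalyticAt ℂ g w → AnalyticAt ℂ (fun z => g (φ z)) w :=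
      fun hg => AnalyticAt.fun_comp (by rwa [hfix]) hφ
    have hderiv : deriv (fun z => ψ z * f (φ z)) =ᶠ[𝓝 w]
        (fun z => deriv ψ z * f (φ z)) + fun z => (ψ * deriv φ) z * deriv f (φ z) := by
      have hfφ : ∀ᶠ z in 𝓝 w, AnalyticAt ℂ f (φ z) :=
        hφ.continuousAt.eventually (by rw [hfix]; exact hf.eventually_analyticAt)
      filter_upwards [hψ.eventually_analyticAt, hφ.eventually_analyticAt, hfφ] with z h1 h2 h3
      have h := h1.differentiableAt.hasDerivAt.mul
        (h3.differentiableAt.hasDerivAt.comp z h2.differentiableAt.hasDerivAt)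
      refine h.deriv.trans ?_
      simp only [Pi.add_apply, Pi.mul_apply, Function.comp_apply]
      ring
    rw [iteratedDeriv_succ', hderiv.iteratedDeriv_eq m]
    refine (iteratedDeriv_add (hψ.deriv.mul (hcomp hf)).contDiffAt
      ((hψ.mul hφ.deriv).mul (hcomp hf.deriv)).contDiffAt).trans ?_
    refine (congrArg₂ (· + ·) (hc f hf) (hd (deriv f) hf.deriv)).trans ?_
    simp only [← iteratedDeriv_succ', add_mul, Finset.sum_add_distrib, Pi.mul_apply]
    have hlow : ∑ j ∈ Finset.range (m + 1),
        (if j < m then c j else deriv ψ w * deriv φ w ^ m) * iteratedDeriv j f w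
          = ∑ j ∈ Finset.range m, c j * iteratedDeriv j f w
            + deriv ψ w * deriv φ w ^ m * iteratedDeriv m f w := by
      rw [Finset.sum_range_succ, if_neg (lt_irrefl m)]
      congr 1
      exact Finset.sum_congr rfl fun j hj => by rw [if_pos (Finset.mem_range.1 hj)]
    rw [hlow, Finset.sum_range_succ']
    simp only [Nat.add_eq_zero_iff, one_ne_zero, and_false, if_false, if_true, zero_mul, add_zero,
      Nat.add_sub_cancel]
    ring

/-- If all derivatives of `ψ` at `w` of order at most `m` vanish, so does the `m`-th derivative of
`ψ * g` at `w`. -/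
theorem iteratedDeriv_mul_eq_zero_of_forall_le {ψ g : ℂ → ℂ} {w : ℂ} {m : ℕ}
    (hψ : AnalyticAt ℂ ψ w) (hg : AnalyticAt ℂ g w) (h : ∀ k ≤ m, iteratedDeriv k ψ w = 0) :
    iteratedDeriv m (fun z => ψ z * g z) w = 0 := by
  refine (iteratedDeriv_mul hψ.contDiffAt hg.contDiffAt).trans (Finset.sum_eq_zero fun i hi => ?_)
  rw [h i (Nat.lt_succ_iff.1 (Finset.mem_range.1 hi)), mul_zero, zero_mul]


/-- Lemma 2 (iii): the `m`-th derivative (`m < n`) of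
`z ↦ ψ₀ z * f (φ₀ z) + ψₙ z * f⁽ⁿ⁾ (φₙ z)` at a fixed point `w` in the open unit disk,
where `ψₙ` vanishes at `w` to order at least `n`; in particular the term coming from the
weighted composition–differentiation operator contributes `0`. -/
theorem stmt_2 (n m : ℕ) (hn : 1 ≤ n) (hm : m < n)
    (w : ℂ) (hw : w ∈ Metric.ball (0 : ℂ) 1)
    (ψ₀ ψₙ φ₀ φₙ : ℂ → ℂ)
    (hψ₀ : DifferentiableOn ℂ ψ₀ (Metric.ball 0 1))
    (hψₙ : DifferentiableOn ℂ ψₙ (Metric.ball 0 1))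
    (hφ₀ : DifferentiableOn ℂ φ₀ (Metric.ball 0 1))
    (hφₙ : DifferentiableOn ℂ φₙ (Metric.ball 0 1))
    (hφ₀m : Set.MapsTo φ₀ (Metric.ball 0 1) (Metric.ball 0 1))
    (hφₙm : Set.MapsTo φₙ (Metric.ball 0 1) (Metric.ball 0 1))
    (hfix₀ : φ₀ w = w) (hfixₙ : φₙ w = w)
    (hzero : ∀ k < n, iteratedDeriv k ψₙ w = 0) :
    ∃ c : ℕ → ℂ, ∀ f : ℂ → ℂ, DifferentiableOn ℂ f (Metric.ball 0 1) →
      iteratedDeriv m (fun z => ψ₀ z * f (φ₀ z) + ψₙ z * iteratedDeriv n f (φₙ z)) w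
        = (∑ j ∈ Finset.range m, c j * iteratedDeriv j f w)
          + ψ₀ w * (deriv φ₀ w) ^ m * iteratedDeriv m f w
      ∧ iteratedDeriv m (fun z => ψₙ z * iteratedDeriv n f (φₙ z)) w = 0 := by
  have hball : Metric.ball (0 : ℂ) 1 ∈ nhds w := Metric.isOpen_ball.mem_nhds hw
  have hψ₀w := hψ₀.analyticAt hball
  have hψₙw := hψₙ.analyticAt hball
  have hφ₀w := hφ₀.analyticAt hball
  have hφₙw := hφₙ.analyticAt hball
  obtain ⟨c, hc⟩ := exists_iteratedDeriv_mul_comp_eq_of_fixed hφ₀w hfix₀ m hψ₀w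
  refine ⟨c, fun f hf => ?_⟩
  have hfw := hf.analyticAt hball
  have hfφ₀ : AnalyticAt ℂ (fun z => f (φ₀ z)) w :=
    AnalyticAt.fun_comp (by rwa [hfix₀]) hφ₀w
  have hfn : AnalyticAt ℂ (iteratedDeriv n f) w := by
    rw [iteratedDeriv_eq_iterate]
    exact hfw.iterated_deriv n
  have hfφₙ : AnalyticAt ℂ (fun z => iteratedDeriv n f (φₙ z)) w :=
    AnalyticAt.fun_comp (by rwa [hfixₙ]) hφₙw
  have hvanish := iteratedDeriv_mul_eq_zero_of_forall_le hψₙw hfφₙ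
    fun k hk => hzero k (hk.trans_lt hm)
  refine ⟨?_, hvanish⟩
  refine (iteratedDeriv_add (hψ₀w.mul hfφ₀).contDiffAt (hψₙw.mul hfφₙ).contDiffAt).trans ?_
  exact (congrArg₂ (· + ·) (hc f hfw) hvanish).trans (add_zero _)
end

section
/- Let n ≥ 1 be an integer, let w ∈ 𝔻, let ψ₀ and ψₙ be analytic functions on 𝔻, and let φ₀ and φₙ be analytic self-maps of 𝔻 with φ₀(w) = w and φₙ(w) = w. Suppose ψₙ has a zero at w of order at least n. If f is analytic on 𝔻, f is not identically zero, λ ∈ ℂ, and λ·f(z) = ψ₀(z)·f(φ₀(z)) + ψₙ(z)·f⁽ⁿ⁾(φₙ(z)) for every z ∈ 𝔻, then λ belongs to the set {ψ₀(w)·(φ₀′(w))^l : l ∈ ℕ, 0 ≤ l ≤ n−1} ∪ {ψ₀(w)·(φ₀′(w))^l + C(l,n)·ψₙ⁽ⁿ⁾(w)·(φₙ′(w))^{l−n} : l ∈ ℕ, l ≥ n}, where C(l,n) denotes the binomial coefficient and (φₙ′(w))^{l−n} is interpreted as 1 when l = n (convention 0⁰ = 1). -/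
open Filter Topology in
/-- If `f` factors near `w` as `(z - w) ^ (k + t)` times an analytic function `g`, its `k`-th
derivative factors as `(z - w) ^ t` times an analytic function with value
`(k + t).descFactorial k * g w` at `w`. -/
lemma iteratedDeriv_eventuallyEq_pow_mul {f g : ℂ → ℂ} {w : ℂ} (k t : ℕ)
    (hg : AnalyticAt ℂ g w) (hfg : ∀ᶠ z in 𝓝 w, f z = (z - w) ^ (k + t) * g z) :
    ∃ G : ℂ → ℂ, AnalyticAt ℂ G w ∧ G w = ((k + t).descFactorial k : ℂ) * g w ∧
      ∀ᶠ z in 𝓝 w, iteratedDeriv k f z = (z - w) ^ t * G z := by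
  induction k generalizing t with
  | zero => exact ⟨g, hg, by simp, by simpa using hfg⟩
  | succ k ih =>
    obtain ⟨G, hG, hGw, hfG⟩ := ih (t + 1) (by simpa [add_assoc, add_comm 1 t] using hfg)
    refine ⟨fun z ↦ (t + 1) * G z + (z - w) * deriv G z, by fun_prop, ?_, ?_⟩
    · have h : k + 1 + t - k = t + 1 := by omega
      simp only [sub_self, zero_mul, add_zero, hGw, Nat.descFactorial_succ, h,
        show k + (t + 1) = k + 1 + t by omega]
      push_cast
      ring
    · filter_upwards [hfG.eventually_nhds, hG.eventually_analyticAt] with z hz hGz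
      have hsub : HasDerivAt (· - w) 1 z := (hasDerivAt_id z).sub_const w
      have hd := (hsub.fun_pow (t + 1)).mul hGz.differentiableAt.hasDerivAt
      rw [iteratedDeriv_succ, EventuallyEq.deriv_eq hz]
      refine hd.deriv.trans ?_
      simp only [Nat.add_sub_cancel, Nat.cast_add, Nat.cast_one]
      ring

open Filter Topology in
/-- A common power of `z - w` can be cancelled from an identity near `w` between continuous
functions, when evaluating at `w`. -/
lemma eq_of_eventually_pow_mul_eq {A B : ℂ → ℂ} {w : ℂ} (m : ℕ) (hA : ContinuousAt A w)
    (hB : ContinuousAt B w) (h : ∀ᶠ z in 𝓝 w, (z - w) ^ m * A z = (z - w) ^ m * B z) :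
    A w = B w := by
  refine (hA.eventuallyEq_nhds_iff_eventuallyEq_nhdsNE hB).1 ?_ |>.eq_of_nhds
  filter_upwards [h.filter_mono nhdsWithin_le_nhds, self_mem_nhdsWithin] with z hz hne
  exact mul_left_cancel₀ (pow_ne_zero _ (sub_ne_zero.2 hne)) hz

open Filter Topology in
/-- Composing a function that factors as `(z - w) ^ m * g z` near `w` with a map fixing `w`. -/
lemma comp_eventuallyEq_pow_mul {f g φ : ℂ → ℂ} {w : ℂ} (m : ℕ)
    (hg : ContinuousAt g w) (hφ : DifferentiableAt ℂ φ w) (hfix : φ w = w)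
    (hfg : ∀ᶠ z in 𝓝 w, f z = (z - w) ^ m * g z) :
    ∃ G : ℂ → ℂ, ContinuousAt G w ∧ G w = deriv φ w ^ m * g w ∧
      ∀ᶠ z in 𝓝 w, f (φ z) = (z - w) ^ m * G z := by
  have ht : Tendsto φ (𝓝 w) (𝓝 w) := by simpa [hfix] using hφ.continuousAt.tendsto
  refine ⟨fun z ↦ dslope φ w z ^ m * g (φ z), ?_, by simp [hfix], ?_⟩
  · exact ((continuousAt_dslope_same.2 hφ).pow m).mul
      (ContinuousAt.comp (by rwa [hfix]) hφ.continuousAt)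
  · filter_upwards [ht.eventually hfg] with z hz
    have h : φ z - w = (z - w) * dslope φ w z := by
      rw [← smul_eq_mul, sub_smul_dslope, hfix]
    rw [hz, h, mul_pow, mul_assoc]

/-- Proposition 3: every eigenvalue of `C_{ψ₀,φ₀} + D_{ψₙ,φₙ,n}` (with common fixed point
`w` in the open unit disk and `ψₙ` vanishing at `w` to order at least `n`) lies in the set
`{ψ₀ w * (φ₀' w)^l : 0 ≤ l ≤ n-1} ∪
 {ψ₀ w * (φ₀' w)^l + C(l,n) * ψₙ⁽ⁿ⁾ w * (φₙ' w)^(l-n) : l ≥ n}`. -/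
theorem stmt_5 (n : ℕ) (hn : 1 ≤ n)
    (w : ℂ) (hw : w ∈ Metric.ball (0 : ℂ) 1)
    (ψ₀ ψₙ φ₀ φₙ : ℂ → ℂ)
    (hψ₀ : DifferentiableOn ℂ ψ₀ (Metric.ball 0 1))
    (hψₙ : DifferentiableOn ℂ ψₙ (Metric.ball 0 1))
    (hφ₀ : DifferentiableOn ℂ φ₀ (Metric.ball 0 1))
    (hφₙ : DifferentiableOn ℂ φₙ (Metric.ball 0 1))
    (hφ₀m : Set.MapsTo φ₀ (Metric.ball 0 1) (Metric.ball 0 1))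
    (hφₙm : Set.MapsTo φₙ (Metric.ball 0 1) (Metric.ball 0 1))
    (hfix₀ : φ₀ w = w) (hfixₙ : φₙ w = w)
    (hzero : ∀ k < n, iteratedDeriv k ψₙ w = 0)
    (f : ℂ → ℂ) (hf : DifferentiableOn ℂ f (Metric.ball 0 1))
    (hfne : ∃ z ∈ Metric.ball (0 : ℂ) 1, f z ≠ 0)
    (lam : ℂ)
    (heig : ∀ z ∈ Metric.ball (0 : ℂ) 1,
      lam * f z = ψ₀ z * f (φ₀ z) + ψₙ z * iteratedDeriv n f (φₙ z)) :
    lam ∈ {μ : ℂ | ∃ l : ℕ, l < n ∧ μ = ψ₀ w * (deriv φ₀ w) ^ l} ∪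
      {μ : ℂ | ∃ l : ℕ, n ≤ l ∧
        μ = ψ₀ w * (deriv φ₀ w) ^ l
            + (l.choose n : ℂ) * iteratedDeriv n ψₙ w * (deriv φₙ w) ^ (l - n)} := by
  have hopen : IsOpen (Metric.ball (0 : ℂ) 1) := Metric.isOpen_ball
  have hnhds : Metric.ball (0 : ℂ) 1 ∈ nhds w := hopen.mem_nhds hw
  have hfa : AnalyticAt ℂ f w := hf.analyticAt hnhds
  have hord : analyticOrderAt f w ≠ ⊤ := by
    intro h
    obtain ⟨z, hz, hfz⟩ := hfne
    exact hfz ((hf.analyticOnNhd hopen).eqOn_zero_of_preconnected_of_eventuallyEq_zero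
      (convex_ball 0 1).isPreconnected hw (analyticOrderAt_eq_top.1 h) hz)
  obtain ⟨g, hg, hgw, hfg⟩ := hfa.analyticOrderAt_ne_top.1 hord
  generalize analyticOrderNatAt f w = m at hfg
  obtain ⟨κ, hκ, hψκ⟩ := (natCast_le_analyticOrderAt (hψₙ.analyticAt hnhds)).1
    ((natCast_le_analyticOrderAt_iff_iteratedDeriv_eq_zero (hψₙ.analyticAt hnhds)).2 hzero)
  simp only [smul_eq_mul] at hfg hψκ
  obtain ⟨F₀, hF₀, hF₀w, hfF₀⟩ := comp_eventuallyEq_pow_mul m hg.continuousAt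
    (hφ₀.differentiableAt hnhds) hfix₀ hfg
  have hψ₀c : ContinuousAt ψ₀ w := (hψ₀.differentiableAt hnhds).continuousAt
  have hφₙc : ContinuousAt φₙ w := (hφₙ.differentiableAt hnhds).continuousAt
  rcases lt_or_ge m n with hmn | hmn
  · refine Or.inl ⟨m, hmn, mul_right_cancel₀ hgw ?_⟩
    have hDc : ContinuousAt (fun z ↦ iteratedDeriv n f (φₙ z)) w := by
      have hD : AnalyticAt ℂ (iteratedDeriv n f) w := by
        rw [iteratedDeriv_eq_iterate]
        exact hfa.iterated_deriv n
      exact ContinuousAt.comp (by simpa [hfixₙ] using hD.continuousAt) hφₙc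
    have key := eq_of_eventually_pow_mul_eq (w := w) m
      (A := fun z ↦ lam * g z)
      (B := fun z ↦ ψ₀ z * F₀ z + (z - w) ^ (n - m) * κ z * iteratedDeriv n f (φₙ z))
      (continuousAt_const.mul hg.continuousAt)
      ((hψ₀c.mul hF₀).add ((ContinuousAt.mul (by fun_prop) hκ.continuousAt).mul hDc)) (by
        filter_upwards [hnhds, hfg, hfF₀, hψκ] with z hz h1 h2 h3
        have h := heig z hz
        rw [h1, h2, h3, ← Nat.add_sub_of_le hmn.le, pow_add, Nat.add_sub_of_le hmn.le] at h
        linear_combination h)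
    have h0 : n - m ≠ 0 := by omega
    simp only [sub_self, zero_pow h0, zero_mul, add_zero, hF₀w] at key
    rw [key, mul_assoc]
  · refine Or.inr ⟨m, hmn, mul_right_cancel₀ hgw ?_⟩
    obtain ⟨D, hD, hDw, hfD⟩ := iteratedDeriv_eventuallyEq_pow_mul n (m - n) hg
      (by rw [Nat.add_sub_of_le hmn]; exact hfg)
    obtain ⟨K, -, hKw, hψK⟩ := iteratedDeriv_eventuallyEq_pow_mul n 0 hκ hψκ
    obtain ⟨Fₙ, hFₙ, hFₙw, hfFₙ⟩ := comp_eventuallyEq_pow_mul (m - n) hD.continuousAt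
      (hφₙ.differentiableAt hnhds) hfixₙ hfD
    have hψw : iteratedDeriv n ψₙ w = (n.factorial : ℂ) * κ w := by
      simpa [hKw, Nat.descFactorial_self] using hψK.self_of_nhds
    have key := eq_of_eventually_pow_mul_eq (w := w) m
      (A := fun z ↦ lam * g z) (B := fun z ↦ ψ₀ z * F₀ z + κ z * Fₙ z)
      (continuousAt_const.mul hg.continuousAt)
      ((hψ₀c.mul hF₀).add (hκ.continuousAt.mul hFₙ)) (by
        filter_upwards [hnhds, hfg, hfF₀, hψκ, hfFₙ] with z hz h1 h2 h3 h4
        have h := heig z hz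
        have hp : (z - w) ^ m = (z - w) ^ n * (z - w) ^ (m - n) := by
          rw [← pow_add, Nat.add_sub_of_le hmn]
        rw [h1, h2, h3, h4] at h
        linear_combination h - κ z * Fₙ z * hp)
    simp only [hF₀w, hFₙw, hDw, Nat.add_sub_of_le hmn,
      Nat.descFactorial_eq_factorial_mul_choose, Nat.cast_mul] at key
    rw [key, hψw]
    ring
end

section
/- Let n ≥ 1 be an integer and let b be a real number with 0 ≤ b < 1. Set L = ⌊n/(1−b)⌋. Then C(L, n)·b^{L−n} is the greatest element of the set {C(l, n)·b^{l−n} : l ∈ ℕ, l ≥ n}; that is, L ≥ n, and for every integer l ≥ n one has C(l, n)·b^{l−n} ≤ C(L, n)·b^{L−n}, where C(·,·) denotes the binomial coefficient, ⌊·⌋ denotes the greatest integer (floor) function, and powers use the convention 0⁰ = 1. -/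
theorem choose_mul_pow_succ (n k : ℕ) (b : ℝ) :
    ((n + (k + 1)).choose n : ℝ) * b ^ (k + 1) * (k + 1) =
      ((n + k).choose n : ℝ) * b ^ k * ((n + k + 1) * b) := by
  have h := Nat.choose_mul_succ_eq (n + k) n
  rw [show n + k + 1 - n = k + 1 by omega] at h
  have h' : ((n + k).choose n : ℝ) * (n + k + 1) = ((n + (k + 1)).choose n : ℝ) * (k + 1) := by
    exact_mod_cast h
  rw [pow_succ]
  linear_combination (-(b ^ k * b)) * h'

theorem choose_mul_pow_le_succ {n k : ℕ} {b : ℝ} (hb : 0 ≤ b)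
    (h : (n + k + 1) * (1 - b) ≤ (n : ℝ)) :
    ((n + k).choose n : ℝ) * b ^ k ≤ ((n + (k + 1)).choose n : ℝ) * b ^ (k + 1) := by
  have hk : (0 : ℝ) < k + 1 := by positivity
  refine le_of_mul_le_mul_right ?_ hk
  rw [choose_mul_pow_succ]
  exact mul_le_mul_of_nonneg_left (by linarith) (by positivity)

theorem choose_mul_pow_succ_le {n k : ℕ} {b : ℝ} (hb : 0 ≤ b)
    (h : (n : ℝ) ≤ (n + k + 1) * (1 - b)) :
    ((n + (k + 1)).choose n : ℝ) * b ^ (k + 1) ≤ ((n + k).choose n : ℝ) * b ^ k := by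
  have hk : (0 : ℝ) < k + 1 := by positivity
  refine le_of_mul_le_mul_right ?_ hk
  rw [choose_mul_pow_succ]
  exact mul_le_mul_of_nonneg_left (by linarith) (by positivity)

/-- The maximum of `l ↦ C(l,n) * b^(l-n)` over integers `l ≥ n` is attained at
`L = ⌊n / (1-b)⌋` when `n ≥ 1` and `0 ≤ b < 1`. -/
theorem stmt_7 (n : ℕ) (hn : 1 ≤ n) (b : ℝ) (hb0 : 0 ≤ b) (hb1 : b < 1) :
    n ≤ ⌊(n : ℝ) / (1 - b)⌋₊ ∧
      ∀ l : ℕ, n ≤ l →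
        (l.choose n : ℝ) * b ^ (l - n) ≤
          ((⌊(n : ℝ) / (1 - b)⌋₊).choose n : ℝ) * b ^ (⌊(n : ℝ) / (1 - b)⌋₊ - n) := by
  have hpos : 0 < 1 - b := by linarith
  have le_floor_iff (m : ℕ) : m ≤ ⌊(n : ℝ) / (1 - b)⌋₊ ↔ (m : ℝ) * (1 - b) ≤ n := by
    rw [Nat.le_floor_iff (by positivity), le_div_iff₀ hpos]
  have hnL : n ≤ ⌊(n : ℝ) / (1 - b)⌋₊ :=
    (le_floor_iff n).2 (mul_le_of_le_one_right n.cast_nonneg (by linarith))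
  refine ⟨hnL, fun l hl => ?_⟩
  generalize ⌊(n : ℝ) / (1 - b)⌋₊ = L at le_floor_iff hnL ⊢
  obtain ⟨k, rfl⟩ := Nat.exists_eq_add_of_le hl
  obtain ⟨K, rfl⟩ := Nat.exists_eq_add_of_le hnL
  simp only [Nat.add_sub_cancel_left]
  rcases le_total k K with hkK | hKk
  · induction hkK using Nat.decreasingInduction with
    | self => exact le_rfl
    | of_succ j hj ih =>
      refine (choose_mul_pow_le_succ hb0 ?_).trans (ih (by omega))
      exact_mod_cast (le_floor_iff (n + j + 1)).1 (by omega)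
  · induction k, hKk using Nat.le_induction with
    | base => exact le_rfl
    | succ j hj ih =>
      refine (choose_mul_pow_succ_le hb0 ?_).trans (ih (by omega))
      have h := (le_floor_iff (n + j + 1)).not.1 (by omega)
      push_cast at h
      exact (not_le.1 h).le
end

section
/- Let n ≥ 1 be an integer and let b ∈ ℂ with 0 < |b| < 1. Let T be a bounded linear operator on the Hilbert space ℓ²(ℕ, ℂ) satisfying (T a)_j = ((j+n)!/j!)·b^j·a_{j+n} for every a ∈ ℓ²(ℕ, ℂ) and every j ∈ ℕ. Then the operator norm of T equals n!·C(⌊n/(1−|b|)⌋, n)·|b|^{⌊n/(1−|b|)⌋−n}, where C(·,·) denotes the binomial coefficient and ⌊·⌋ the floor function. -/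
/-- The modulus of the `j`-th weight of the weighted backward shift representing `D_{φ,n}`
with `φ(z) = b z` and `r = |b|`. -/
noncomputable def shiftWeight (n : ℕ) (r : ℝ) (j : ℕ) : ℝ :=
  n.factorial * (j + n).choose n * r ^ j

theorem shiftWeight_nonneg (n : ℕ) {r : ℝ} (hr : 0 ≤ r) (j : ℕ) : 0 ≤ shiftWeight n r j := by
  unfold shiftWeight
  positivity

theorem succ_mul_shiftWeight_succ (n : ℕ) (r : ℝ) (j : ℕ) :
    (j + 1) * shiftWeight n r (j + 1) = r * (j + 1 + n) * shiftWeight n r j := by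
  have h := Nat.choose_mul_succ_eq (j + n) n
  rw [show j + n + 1 - n = j + 1 by omega, show j + n + 1 = j + 1 + n by omega] at h
  have h' : ((j + n).choose n : ℝ) * (j + 1 + n) = (j + 1 + n).choose n * (j + 1) := by
    exact_mod_cast h
  simp only [shiftWeight, pow_succ]
  linear_combination -(n.factorial : ℝ) * r ^ j * r * h'

theorem shiftWeight_le_succ {n : ℕ} {r : ℝ} (hr : 0 ≤ r) {j : ℕ}
    (h : j + 1 ≤ r * (j + 1 + n)) : shiftWeight n r j ≤ shiftWeight n r (j + 1) := by
  have hj : (0 : ℝ) < j + 1 := by positivity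
  refine le_of_mul_le_mul_left ?_ hj
  rw [succ_mul_shiftWeight_succ]
  exact mul_le_mul_of_nonneg_right h (shiftWeight_nonneg n hr j)

theorem shiftWeight_succ_le {n : ℕ} {r : ℝ} (hr : 0 ≤ r) {j : ℕ}
    (h : r * (j + 1 + n) ≤ j + 1) : shiftWeight n r (j + 1) ≤ shiftWeight n r j := by
  have hj : (0 : ℝ) < j + 1 := by positivity
  refine le_of_mul_le_mul_left ?_ hj
  rw [succ_mul_shiftWeight_succ]
  exact mul_le_mul_of_nonneg_right h (shiftWeight_nonneg n hr j)

/-- The weights are unimodal, with peak at `⌊n / (1 - r)⌋ - n`. -/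
theorem shiftWeight_le_peak (n : ℕ) {r : ℝ} (hr0 : 0 ≤ r) (hr1 : r < 1) (j : ℕ) :
    shiftWeight n r j ≤ shiftWeight n r (⌊(n : ℝ) / (1 - r)⌋₊ - n) := by
  have hr : 0 < 1 - r := sub_pos.2 hr1
  have up : ∀ i, i + 1 + n ≤ ⌊(n : ℝ) / (1 - r)⌋₊ →
      shiftWeight n r i ≤ shiftWeight n r (i + 1) := by
    intro i hi
    rw [Nat.le_floor_iff (by positivity), le_div_iff₀ hr] at hi
    push_cast at hi
    exact shiftWeight_le_succ hr0 (by linarith)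
  have down : ∀ i, ⌊(n : ℝ) / (1 - r)⌋₊ < i + 1 + n →
      shiftWeight n r (i + 1) ≤ shiftWeight n r i := by
    intro i hi
    rw [Nat.floor_lt (by positivity), div_lt_iff₀ hr] at hi
    push_cast at hi
    exact shiftWeight_succ_le hr0 (by linarith)
  rcases le_total j (⌊(n : ℝ) / (1 - r)⌋₊ - n) with hj | hj
  · refine Nat.decreasingInduction' (P := fun i ↦ shiftWeight n r i ≤ _) ?_ hj le_rfl
    exact fun i hi _ ih ↦ (up i (by omega)).trans ih
  · induction j, hj using Nat.le_induction with
    | base => exact le_rfl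
    | succ i hi ih => exact (down i (by omega)).trans ih

/-- A weighted backward shift on `ℓ²` with weights bounded by `C` has norm at most `C`. -/
theorem opNorm_le_of_backwardShift {n : ℕ} {c : ℕ → ℂ} {C : ℝ} (hC : 0 ≤ C)
    (hc : ∀ j, ‖c j‖ ≤ C) (T : lp (fun _ : ℕ => ℂ) 2 →L[ℂ] lp (fun _ : ℕ => ℂ) 2)
    (hT : ∀ (a : lp (fun _ : ℕ => ℂ) 2) (j : ℕ), (T a) j = c j * a (j + n)) :
    ‖T‖ ≤ C := by
  have h2 : 0 < (2 : ENNReal).toReal := by norm_num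
  refine T.opNorm_le_bound hC fun a ↦ ?_
  refine lp.norm_le_of_forall_sum_le h2 (by positivity) fun s ↦ ?_
  calc ∑ j ∈ s, ‖(T a) j‖ ^ (2 : ENNReal).toReal
      ≤ ∑ j ∈ s, C ^ (2 : ENNReal).toReal * ‖a (j + n)‖ ^ (2 : ENNReal).toReal := by
        refine Finset.sum_le_sum fun j _ ↦ ?_
        rw [hT, norm_mul, Real.mul_rpow (norm_nonneg _) (norm_nonneg _)]
        gcongr
        exact hc j
    _ = C ^ (2 : ENNReal).toReal *
          ∑ i ∈ s.map (addRightEmbedding n), ‖a i‖ ^ (2 : ENNReal).toReal := by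
        rw [Finset.sum_map, Finset.mul_sum]
        rfl
    _ ≤ C ^ (2 : ENNReal).toReal * ‖a‖ ^ (2 : ENNReal).toReal := by
        gcongr
        exact lp.sum_rpow_le_norm_rpow h2 a _
    _ = (C * ‖a‖) ^ (2 : ENNReal).toReal := (Real.mul_rpow hC (norm_nonneg _)).symm

/-- Each weight of a weighted backward shift on `ℓ²` is bounded by the norm of the shift. -/
theorem norm_weight_le_opNorm_of_backwardShift {n : ℕ} {c : ℕ → ℂ}
    (T : lp (fun _ : ℕ => ℂ) 2 →L[ℂ] lp (fun _ : ℕ => ℂ) 2)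
    (hT : ∀ (a : lp (fun _ : ℕ => ℂ) 2) (j : ℕ), (T a) j = c j * a (j + n)) (j : ℕ) :
    ‖c j‖ ≤ ‖T‖ := by
  have h := T.le_opNorm (lp.single 2 (j + n) (1 : ℂ))
  rw [lp.norm_single (by norm_num), norm_one, mul_one] at h
  refine le_trans ?_ ((lp.norm_apply_le_norm two_ne_zero _ j).trans h)
  rw [hT, lp.single_apply_self, mul_one]

/-- Theorem 8: the norm of the composition–differentiation operator `D_{φ,n}` with
`φ(z) = b z`, `0 < |b| < 1`, on the Hardy space `H²` (identified with `ℓ²(ℕ, ℂ)` via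
Taylor coefficients, where `(T a)_j = ((j+n)!/j!) b^j a_{j+n}`) equals
`n! * C(⌊n/(1-|b|)⌋, n) * |b|^(⌊n/(1-|b|)⌋ - n)`. -/
theorem stmt_9 (n : ℕ) (hn : 1 ≤ n) (b : ℂ) (hb0 : 0 < ‖b‖) (hb1 : ‖b‖ < 1)
    (T : lp (fun _ : ℕ => ℂ) 2 →L[ℂ] lp (fun _ : ℕ => ℂ) 2)
    (hT : ∀ (a : lp (fun _ : ℕ => ℂ) 2) (j : ℕ),
      (T a) j = (((j + n).factorial / j.factorial : ℕ) : ℂ) * b ^ j * a (j + n)) :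
    ‖T‖ = (n.factorial : ℝ) * ((⌊(n : ℝ) / (1 - ‖b‖)⌋₊).choose n : ℝ)
        * ‖b‖ ^ (⌊(n : ℝ) / (1 - ‖b‖)⌋₊ - n) := by
  have hw : ∀ j, ‖(((j + n).factorial / j.factorial : ℕ) : ℂ) * b ^ j‖ = shiftWeight n ‖b‖ j := by
    intro j
    have h : (j + n).factorial / j.factorial = n.factorial * (j + n).choose n := by
      refine Nat.div_eq_of_eq_mul_left j.factorial_pos ?_
      rw [← Nat.add_choose_mul_factorial_mul_factorial j n]
      ring
    rw [h, norm_mul, norm_pow, Complex.norm_natCast, Nat.cast_mul, shiftWeight]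
  have hN : n ≤ ⌊(n : ℝ) / (1 - ‖b‖)⌋₊ := by
    rw [Nat.le_floor_iff (by have := sub_pos.2 hb1; positivity), le_div_iff₀ (sub_pos.2 hb1)]
    exact mul_le_of_le_one_right n.cast_nonneg (by linarith)
  have hpeak : ‖T‖ = shiftWeight n ‖b‖ (⌊(n : ℝ) / (1 - ‖b‖)⌋₊ - n) := by
    refine le_antisymm (opNorm_le_of_backwardShift (shiftWeight_nonneg n hb0.le _) ?_ T hT) ?_
    · exact fun j ↦ (hw j).trans_le (shiftWeight_le_peak n hb0.le hb1 j)
    · exact (hw _).symm.trans_le (norm_weight_le_opNorm_of_backwardShift T hT _)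
  rw [hpeak, shiftWeight, Nat.sub_add_cancel hN]
end

section
/- Let n ≥ 1 be an integer, let a ∈ ℂ with a ≠ 0, and let b ∈ ℂ with 0 < |b| < 1. Let T be a bounded linear operator on the Hilbert space ℓ²(ℕ, ℂ) satisfying, for every c ∈ ℓ²(ℕ, ℂ): (T c)_k = a·(k!/(k−n)!)·b^{k−n}·c_k for every k ≥ n, and (T c)_k = 0 for every k < n. Then the operator norm of T equals n!·|a|·C(⌊n/(1−|b|)⌋, n)·|b|^{⌊n/(1−|b|)⌋−n}, where C(·,·) denotes the binomial coefficient and ⌊·⌋ the floor function. -/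
/-- The consecutive terms of the sequence `k ↦ C(k, n) r ^ (k - n)` have ratio
`(k + 1) r / (k + 1 - n)`. -/
theorem choose_succ_mul_pow_mul (n k : ℕ) (h : n ≤ k) (r : ℝ) :
    ((k + 1).choose n : ℝ) * r ^ (k + 1 - n) * (k + 1 - n) =
      (k.choose n : ℝ) * r ^ (k - n) * ((k + 1) * r) := by
  have hc : (k.choose n : ℝ) * (k + 1) = ((k + 1).choose n : ℝ) * (k + 1 - n) := by
    have := congrArg (Nat.cast (R := ℝ)) (Nat.choose_mul_succ_eq k n)
    push_cast [Nat.cast_sub (Nat.le_succ_of_le h)] at this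
    exact this
  rw [Nat.succ_sub h, pow_succ]
  linear_combination (-(r ^ (k - n) * r)) * hc

/-- For `0 ≤ r < 1` the sequence `k ↦ C(k, n) r ^ (k - n)` attains its maximum over `k ≥ n`
at `k = ⌊n / (1 - r)⌋`. -/
theorem choose_mul_pow_le_floor (n k : ℕ) (h : n ≤ k) {r : ℝ} (hr0 : 0 ≤ r) (hr1 : r < 1) :
    (k.choose n : ℝ) * r ^ (k - n) ≤
      ((⌊(n : ℝ) / (1 - r)⌋₊).choose n : ℝ) * r ^ (⌊(n : ℝ) / (1 - r)⌋₊ - n) := by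
  have hs : 0 < 1 - r := sub_pos.2 hr1
  set M := ⌊(n : ℝ) / (1 - r)⌋₊ with hM
  have hiff (j : ℕ) : j + 1 ≤ M ↔ ((j : ℝ) + 1) * (1 - r) ≤ n := by
    rw [hM, Nat.le_floor_iff (by positivity), le_div_iff₀ hs]
    push_cast
    rfl
  have hpos {j : ℕ} (hj : n ≤ j) : (0 : ℝ) < j + 1 - n := by
    have : (n : ℝ) ≤ j := Nat.cast_le.2 hj
    linarith
  rcases le_total k M with hkM | hMk
  · have hmono (m : ℕ) (hkm : k ≤ m) (hm : m ≤ M) :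
        (k.choose n : ℝ) * r ^ (k - n) ≤ (m.choose n : ℝ) * r ^ (m - n) := by
      induction m, hkm using Nat.le_induction with
      | base => rfl
      | succ m hkm ih =>
        refine (ih (Nat.le_of_succ_le hm)).trans ?_
        have hnm := h.trans hkm
        refine le_of_mul_le_mul_right ?_ (hpos hnm)
        rw [choose_succ_mul_pow_mul n m hnm r]
        have := (hiff m).1 hm
        gcongr
        linarith
    exact hmono M hkM le_rfl
  · have hnM : n ≤ M := by
      rw [hM, Nat.le_floor_iff (by positivity), le_div_iff₀ hs]
      exact mul_le_of_le_one_right (by positivity) (by linarith)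
    clear h
    induction k, hMk using Nat.le_induction with
    | base => rfl
    | succ m hMm ih =>
      refine le_trans ?_ ih
      have hnm := hnM.trans hMm
      refine le_of_mul_le_mul_right ?_ (hpos hnm)
      rw [choose_succ_mul_pow_mul n m hnm r]
      have := lt_of_not_ge (mt (hiff m).2 (by omega))
      gcongr
      linarith

/-- Proposition 7 (norm formula, Hardy-space case): the weighted
composition–differentiation operator `D_{ψ,φ,n}` with `ψ(z) = a zⁿ`, `φ(z) = b z`,
`a ≠ 0`, `0 < |b| < 1`, identified with the diagonal operator
`(T c)_k = a (k!/(k-n)!) b^(k-n) c_k` for `k ≥ n` (and `(T c)_k = 0` for `k < n`)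
on `ℓ²(ℕ, ℂ)`, has norm `n! * |a| * C(⌊n/(1-|b|)⌋, n) * |b|^(⌊n/(1-|b|)⌋ - n)`. -/
theorem stmt_10 (n : ℕ) (hn : 1 ≤ n) (a : ℂ) (ha : a ≠ 0)
    (b : ℂ) (hb0 : 0 < ‖b‖) (hb1 : ‖b‖ < 1)
    (T : lp (fun _ : ℕ => ℂ) 2 →L[ℂ] lp (fun _ : ℕ => ℂ) 2)
    (hT1 : ∀ (c : lp (fun _ : ℕ => ℂ) 2) (k : ℕ), n ≤ k →
      (T c) k = a * ((k.factorial / (k - n).factorial : ℕ) : ℂ) * b ^ (k - n) * c k)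
    (hT2 : ∀ (c : lp (fun _ : ℕ => ℂ) 2) (k : ℕ), k < n → (T c) k = 0) :
    ‖T‖ = (n.factorial : ℝ) * ‖a‖ * ((⌊(n : ℝ) / (1 - ‖b‖)⌋₊).choose n : ℝ)
        * ‖b‖ ^ (⌊(n : ℝ) / (1 - ‖b‖)⌋₊ - n) := by
  set M := ⌊(n : ℝ) / (1 - ‖b‖)⌋₊ with hM
  have hs : 0 < 1 - ‖b‖ := sub_pos.2 hb1
  have hnM : n ≤ M := by
    rw [hM, Nat.le_floor_iff (by positivity), le_div_iff₀ hs]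
    exact mul_le_of_le_one_right (by positivity) (by linarith)
  have hnorm (c : lp (fun _ : ℕ => ℂ) 2) (k : ℕ) (hk : n ≤ k) :
      ‖(T c) k‖ = (n.factorial : ℝ) * ‖a‖ * ((k.choose n : ℝ) * ‖b‖ ^ (k - n)) * ‖c k‖ := by
    rw [hT1 c k hk, ← Nat.descFactorial_eq_div hk, Nat.descFactorial_eq_factorial_mul_choose]
    simp only [norm_mul, norm_pow, Complex.norm_natCast]
    push_cast
    ring
  apply le_antisymm
  · refine T.opNorm_le_bound (by positivity) fun c => ?_
    set K : ℝ := (n.factorial : ℝ) * ‖a‖ * (M.choose n : ℝ) * ‖b‖ ^ (M - n) with hK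
    have hK0 : 0 ≤ K := by positivity
    have hKc : ‖(K : ℂ) • c‖ = K * ‖c‖ := by
      rw [norm_smul, Complex.norm_of_nonneg hK0]
    rw [← hKc]
    refine lp.norm_mono two_ne_zero fun k => ?_
    rw [lp.coeFn_smul, Pi.smul_apply, norm_smul, Complex.norm_of_nonneg hK0]
    rcases lt_or_ge k n with hk | hk
    · rw [hT2 c k hk, norm_zero]
      positivity
    · rw [hnorm c k hk, hK, mul_assoc _ (M.choose n : ℝ)]
      gcongr ?_ * _
      exact mul_le_mul_of_nonneg_left
        (choose_mul_pow_le_floor n k hk (norm_nonneg b) hb1) (by positivity)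
  · have h := (lp.norm_apply_le_norm two_ne_zero (T (lp.single 2 M 1)) M).trans
      (T.le_opNorm (lp.single 2 M 1))
    rw [hnorm _ M hnM, lp.norm_single (by norm_num), lp.single_apply_self] at h
    simpa [mul_assoc] using h
end
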